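/- arXiv:1712.08874 — 3 statements merged into one kernel-verified Lean document; each statement's English description precedes it below -/
import Mathlib

section
/- Let r > 1 be an integer and δ > 0, and let u₁, …, u_m ∈ ℂ^d be vectors such that Σᵢ₌₁^m uᵢuᵢ* = I_d and ‖uᵢ‖² ≤ δ for all i. Then there exists a partition {A₁, …, A_r} of {1, …, m} such that for every j = 1, …, r, ‖Σ_{i ∈ A_j} uᵢuᵢ*‖ ≤ (1/r)(1 + √(rδ))². -/
noncomputable section

/-- The rank-one outer product `v v*` of a vector `v ∈ ℂ^d`, as a d×d matrix. -/
def outer {d : ℕ} (v : EuclideanSpace ℂ (Fin d)) : Matrix (Fin d) (Fin d) ℂ :=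
  fun i j => v i * (starRingEnd ℂ) (v j)

/-- The operator norm (largest singular value) of a complex d×d matrix. -/
def matOpNorm {d : ℕ} (M : Matrix (Fin d) (Fin d) ℂ) : ℝ :=
  ‖Matrix.toEuclideanCLM (𝕜 := ℂ) M‖

/-! ### Logarithmic derivatives of complex polynomials with constrained roots -/

namespace Polynomial

open Complex

theorem exists_prod_eq_of_roots (K : ℂ[X]) :
    K = C K.leadingCoeff * (K.roots.map fun τ => X - C τ).prod :=
  (IsAlgClosed.splits K).eq_prod_roots

/-- If all roots lie in the open lower half-plane, so do the values of the logarithmic derivative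
on the closed upper half-plane, unless it vanishes. -/
theorem im_logDeriv_neg_or_eq_zero {K : ℂ[X]} (h : ∀ τ, K.eval τ = 0 → τ.im < 0)
    (h0 : K.eval 0 ≠ 0) :
    (K.derivative.eval 0 / K.eval 0).im < 0 ∨ K.derivative.eval 0 / K.eval 0 = 0 := by
  rw [(IsAlgClosed.splits K).eval_derivative_div_eval_of_ne_zero h0]
  have hK : K ≠ 0 := by rintro rfl; simp at h0
  have hr : ∀ τ ∈ K.roots, τ.im < 0 := fun τ hτ => h τ ((mem_roots hK).1 hτ)
  generalize K.roots = s at hr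
  induction s using Multiset.induction_on with
  | empty => simp
  | cons a s ih =>
    have ha : a.im < 0 := hr a (by simp)
    have ha' : (1 / (0 - a)).im < 0 := by
      have : a ≠ 0 := by rintro rfl; simp at ha
      have h1 : 0 < normSq a := normSq_pos.2 this
      rw [zero_sub, one_div, inv_im, normSq_neg, neg_im, neg_neg]
      exact div_neg_of_neg_of_pos ha h1
    left
    rw [Multiset.map_cons, Multiset.sum_cons, add_im]
    rcases ih (fun τ hτ => hr τ (by simp [hτ])) with h1 | h1
    · linarith
    · rw [h1]; simpa using ha'

theorem im_logDeriv_nonpos {K : ℂ[X]} (h : ∀ τ, K.eval τ = 0 → τ.im ≤ 0)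
    (h0 : K.eval 0 ≠ 0) : (K.derivative.eval 0 / K.eval 0).im ≤ 0 := by
  rw [(IsAlgClosed.splits K).eval_derivative_div_eval_of_ne_zero h0]
  have hK : K ≠ 0 := by rintro rfl; simp at h0
  have hr : ∀ τ ∈ K.roots, τ.im ≤ 0 := fun τ hτ => h τ ((mem_roots hK).1 hτ)
  generalize K.roots = s at hr
  induction s using Multiset.induction_on with
  | empty => simp
  | cons a s ih =>
    have ha : a.im ≤ 0 := hr a (by simp)
    have ha' : (1 / (0 - a)).im ≤ 0 := by
      rw [zero_sub, one_div, inv_im, normSq_neg, neg_im, neg_neg]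
      exact div_nonpos_of_nonpos_of_nonneg ha (normSq_nonneg _)
    rw [Multiset.map_cons, Multiset.sum_cons, add_im]
    linarith [ih (fun τ hτ => hr τ (by simp [hτ]))]

theorem re_logDeriv_nonneg {K : ℂ[X]} (h : ∀ τ, K.eval τ = 0 → τ.re ≤ 0)
    (h0 : K.eval 0 ≠ 0) : 0 ≤ (K.derivative.eval 0 / K.eval 0).re := by
  rw [(IsAlgClosed.splits K).eval_derivative_div_eval_of_ne_zero h0]
  have hK : K ≠ 0 := by rintro rfl; simp at h0
  have hr : ∀ τ ∈ K.roots, τ.re ≤ 0 := fun τ hτ => h τ ((mem_roots hK).1 hτ)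
  generalize K.roots = s at hr
  induction s using Multiset.induction_on with
  | empty => simp
  | cons a s ih =>
    have ha' : 0 ≤ (1 / (0 - a)).re := by
      rw [zero_sub, one_div, inv_re, normSq_neg, neg_re]
      exact div_nonneg (by linarith [hr a (by simp)]) (normSq_nonneg _)
    rw [Multiset.map_cons, Multiset.sum_cons, add_re]
    linarith [ih (fun τ hτ => hr τ (by simp [hτ]))]

/-- If the roots are real and negative, a bound on the logarithmic derivative at the origin keeps
them away from the origin. -/
theorem neg_inv_re_le_logDeriv {K : ℂ[X]} (h : ∀ τ, K.eval τ = 0 → τ.im = 0 ∧ τ.re < 0)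
    (h0 : K.eval 0 ≠ 0) {τ : ℂ} (hτ : K.eval τ = 0) :
    -τ.re⁻¹ ≤ (K.derivative.eval 0 / K.eval 0).re := by
  rw [(IsAlgClosed.splits K).eval_derivative_div_eval_of_ne_zero h0]
  have hK : K ≠ 0 := by rintro rfl; simp at h0
  have hr : ∀ τ ∈ K.roots, τ.im = 0 ∧ τ.re < 0 := fun τ hτ => h τ ((mem_roots hK).1 hτ)
  replace hτ : τ ∈ K.roots := (mem_roots hK).2 hτ
  have hterm : ∀ a : ℂ, a.im = 0 → (1 / (0 - a)).re = -a.re⁻¹ := by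
    intro a ha
    rw [zero_sub, one_div, inv_re, normSq_neg, neg_re, normSq_apply, ha]
    rcases eq_or_ne a.re 0 with h | h
    · simp [h]
    · field_simp
      simp
  have hsum : ∀ s : Multiset ℂ, (∀ τ ∈ s, τ.im = 0 ∧ τ.re < 0) →
      0 ≤ (s.map fun τ => 1 / (0 - τ)).sum.re ∧
        ∀ τ ∈ s, -τ.re⁻¹ ≤ (s.map fun τ => 1 / (0 - τ)).sum.re := by
    intro s hs
    induction s using Multiset.induction_on with
    | empty => simp
    | cons a s ih =>
      obtain ⟨h1, h2⟩ := ih fun τ hτ => hs τ (by simp [hτ])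
      obtain ⟨h3, h4⟩ := hs a (by simp)
      have h5 : 0 < -a.re⁻¹ := by simpa using h4
      simp only [Multiset.map_cons, Multiset.sum_cons, add_re, hterm a h3, Multiset.mem_cons]
      refine ⟨by linarith, ?_⟩
      rintro τ (rfl | hτ)
      · linarith
      · linarith [h2 τ hτ]
  exact (hsum _ hr).2 τ hτ

/-- The logarithmic derivative of a polynomial whose roots lie in the open left half-plane is
bounded, and decays, on the closed right half-plane. -/
theorem exists_norm_logDeriv_le {K : ℂ[X]} (hK : K ≠ 0) (h : ∀ τ, K.eval τ = 0 → τ.re < 0) :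
    ∃ B : ℝ, 0 ≤ B ∧ ∀ t : ℂ, 0 ≤ t.re → ‖K.derivative.eval t / K.eval t‖ ≤ B / (1 + t.re) := by
  have hr : ∀ τ ∈ K.roots, τ.re < 0 := fun τ hτ => h τ ((mem_roots hK).1 hτ)
  suffices ∃ B : ℝ, 0 ≤ B ∧ ∀ t : ℂ, 0 ≤ t.re →
      ‖(K.roots.map fun τ => 1 / (t - τ)).sum‖ ≤ B / (1 + t.re) by
    obtain ⟨B, hB0, hB⟩ := this
    refine ⟨B, hB0, fun t ht => ?_⟩
    rw [(IsAlgClosed.splits K).eval_derivative_div_eval_of_ne_zero]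
    · exact hB t ht
    · intro hc
      linarith [h t hc]
  generalize K.roots = s at hr
  induction s using Multiset.induction_on with
  | empty => exact ⟨0, le_rfl, by simp⟩
  | cons a s ih =>
    obtain ⟨B, hB0, hB⟩ := ih (fun τ hτ => hr τ (by simp [hτ]))
    have ha := hr a (by simp)
    have hp : 0 < 1 / (-a.re) := one_div_pos.2 (by linarith)
    refine ⟨(1 + 1 / (-a.re)) + B, by linarith, fun t ht => ?_⟩
    rw [Multiset.map_cons, Multiset.sum_cons, add_div]
    refine (norm_add_le _ _).trans (add_le_add ?_ (hB t ht))
    have h1 : 0 < t.re - a.re := by linarith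
    have h2 := re_le_norm (t - a)
    rw [sub_re] at h2
    rw [norm_div, norm_one]
    refine (one_div_le_one_div_of_le h1 h2).trans ?_
    rw [div_le_div_iff₀ h1 (by linarith), one_mul]
    have h3 : 1 / (-a.re) * (-a.re) = 1 := one_div_mul_cancel (by linarith)
    nlinarith [mul_nonneg hp.le ht]

/-- The negative of the second logarithmic derivative at the origin. -/
def secondLogDeriv (K : ℂ[X]) : ℂ :=
  (K.derivative.eval 0 ^ 2 - K.derivative.derivative.eval 0 * K.eval 0) / K.eval 0 ^ 2

theorem secondLogDeriv_mul {K L : ℂ[X]} (hK : K.eval 0 ≠ 0) (hL : L.eval 0 ≠ 0) :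
    secondLogDeriv (K * L) = secondLogDeriv K + secondLogDeriv L := by
  simp only [secondLogDeriv, derivative_mul, derivative_add, eval_add, eval_mul]
  field_simp
  ring

theorem im_secondLogDeriv_nonpos {K : ℂ[X]} (h : ∀ τ, K.eval τ = 0 → τ.im ≤ 0 ∧ τ.re < 0)
    (h0 : K.eval 0 ≠ 0) : (secondLogDeriv K).im ≤ 0 := by
  have hK : K ≠ 0 := by rintro rfl; simp at h0
  have hr : ∀ τ ∈ K.roots, τ.im ≤ 0 ∧ τ.re < 0 := fun τ hτ => h τ ((mem_roots hK).1 hτ)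
  rw [exists_prod_eq_of_roots K]
  generalize K.roots = s at hr
  have hl : K.leadingCoeff ≠ 0 := by simpa using hK
  generalize K.leadingCoeff = l at hl
  suffices (s.map fun τ => X - C τ).prod.eval 0 ≠ 0 ∧
      (secondLogDeriv (s.map fun τ => X - C τ).prod).im ≤ 0 by
    rw [secondLogDeriv_mul (by simpa using hl) this.1]
    simpa [secondLogDeriv] using this.2
  induction s using Multiset.induction_on with
  | empty => simp [secondLogDeriv]
  | cons a s ih =>
    obtain ⟨ha, ha'⟩ := hr a (by simp)
    have hne : a ≠ 0 := by rintro rfl; simp at ha'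
    obtain ⟨h1, h2⟩ := ih fun τ hτ => hr τ (by simp [hτ])
    rw [Multiset.map_cons, Multiset.prod_cons]
    refine ⟨by simpa [hne] using h1, ?_⟩
    rw [secondLogDeriv_mul (by simpa using hne) h1, add_im]
    have : (secondLogDeriv (X - C a)).im ≤ 0 := by
      have h3 : secondLogDeriv (X - C a) = (a ^ 2)⁻¹ := by
        simp [secondLogDeriv]
      rw [h3, inv_im]
      apply div_nonpos_of_nonpos_of_nonneg _ (normSq_nonneg _)
      rw [sq, mul_im]
      nlinarith
    linarith

/-- Sign conditions on the first two derivatives of `g / h` at the origin, for polynomials `h`, `g`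
such that `g / h` maps the upper half-plane to the lower one. -/
theorem logDeriv_signs {h g : ℂ[X]} {B : ℝ} {h0 h1 h2 g0 g1 g2 : ℝ}
    (hroot : ∀ τ, h.eval τ = 0 → τ.im = 0 ∧ τ.re < 0)
    (hup : ∀ t : ℂ, 0 < t.im → (g.eval t / h.eval t).im ≤ 0)
    (hlow : ∀ t : ℂ, 0 ≤ t.re → t.im ≤ 0 → (g.eval t / h.eval t).im ≤ B)
    (eh0 : h.eval 0 = h0) (eh1 : h.derivative.eval 0 = h1)
    (eh2 : h.derivative.derivative.eval 0 = h2)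
    (eg0 : g.eval 0 = g0) (eg1 : g.derivative.eval 0 = g1)
    (eg2 : g.derivative.derivative.eval 0 = g2) :
    g1 * h0 - g0 * h1 ≤ 0 ∧
      0 ≤ h0 * (h0 * (g2 * h0 + h2 * g0 - 2 * h1 * g1) - 2 * g0 * (h2 * h0 - h1 ^ 2)) := by
  have hh0 : h0 ≠ 0 := by
    rintro rfl
    have := (hroot 0 (by simpa using eh0)).2
    simp at this
  have key : ∀ ε : ℝ, 0 < ε → ε * B < 1 → ∀ τ, (h + C (I * ε) * g).eval τ = 0 →
      τ.im ≤ 0 ∧ τ.re < 0 := by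
    intro ε hε hB τ hτ
    by_cases hz : h.eval τ = 0
    · exact ⟨(hroot τ hz).1.le, (hroot τ hz).2⟩
    have e : 1 + I * ε * (g.eval τ / h.eval τ) = 0 := by
      field_simp
      simpa [mul_assoc] using hτ
    have e' : ε * (g.eval τ / h.eval τ).im = 1 := by
      have := congrArg re e
      simp only [add_re, one_re, mul_re, I_re, I_im, ofReal_re, ofReal_im, mul_im, zero_re] at this
      linarith
    have him : τ.im ≤ 0 := by
      by_contra! hc
      have := hup τ hc
      nlinarith
    refine ⟨him, ?_⟩
    by_contra! hc
    have := hlow τ hc him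
    nlinarith
  have hev : ∀ᶠ ε : ℝ in nhdsWithin 0 (Set.Ioi 0), 0 < ε ∧ ε * B < 1 := by
    have : Filter.Tendsto (fun ε : ℝ => ε * B) (nhdsWithin 0 (Set.Ioi 0)) (nhds 0) := by
      have : Continuous fun ε : ℝ => ε * B := by fun_prop
      simpa using (this.tendsto 0).mono_left nhdsWithin_le_nhds
    exact Filter.Eventually.and self_mem_nhdsWithin (this.eventually_lt_const one_pos)
  have hne : ∀ ε : ℝ, (h0 : ℂ) + I * ε * g0 ≠ 0 := by
    intro ε hc
    have := congrArg re hc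
    simp at this
    exact hh0 this
  constructor
  · obtain ⟨ε, hε, hB⟩ := hev.exists
    have h3 := im_logDeriv_nonpos (K := h + C (I * ε) * g) (fun τ hτ => (key ε hε hB τ hτ).1)
      (by simpa [eh0, eg0] using hne ε)
    simp only [derivative_add, derivative_C_mul, eval_add, eval_C_mul, eh0, eh1, eg0, eg1] at h3
    have hn := normSq_pos.2 (hne ε)
    rw [div_im, ← sub_div] at h3
    have h4 := (div_le_iff₀ hn).1 h3
    simp at h4
    nlinarith
  · have h5 : ∀ᶠ ε : ℝ in nhdsWithin 0 (Set.Ioi 0),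
        0 ≤ h0 * (h0 * (g2 * h0 + h2 * g0 - 2 * h1 * g1) - 2 * g0 * (h2 * h0 - h1 ^ 2))
          + ε ^ 2 * ((g2 * g0 - g1 ^ 2) * 2 * h0 * g0
            - g0 ^ 2 * (g2 * h0 + h2 * g0 - 2 * h1 * g1)) := by
      filter_upwards [hev] with ε ⟨hε, hB⟩
      have h3 := im_secondLogDeriv_nonpos (K := h + C (I * ε) * g) (key ε hε hB)
        (by simpa [eh0, eg0] using hne ε)
      simp only [secondLogDeriv, derivative_add, derivative_C_mul, eval_add, eval_C_mul, eh0, eh1,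
        eg0, eg1, eh2, eg2] at h3
      have hn := normSq_pos.2 (pow_ne_zero 2 (hne ε))
      rw [div_im, ← sub_div] at h3
      have h4 := (div_le_iff₀ hn).1 h3
      simp [pow_two] at h4
      refine nonneg_of_mul_nonneg_right (a := ε) ?_ hε
      linarith
    have : Continuous fun ε : ℝ =>
        h0 * (h0 * (g2 * h0 + h2 * g0 - 2 * h1 * g1) - 2 * g0 * (h2 * h0 - h1 ^ 2))
          + ε ^ 2 * ((g2 * g0 - g1 ^ 2) * 2 * h0 * g0
            - g0 ^ 2 * (g2 * h0 + h2 * g0 - 2 * h1 * g1)) := by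
      fun_prop
    have h6 := ge_of_tendsto ((this.tendsto 0).mono_left nhdsWithin_le_nhds) h5
    simpa using h6

end Polynomial

/-! ### Real stable polynomials -/

namespace MvPolynomial

open Complex

variable {ι : Type*}

/-- The directional derivative `∑ i, a i • ∂ᵢ`. -/
def dirDeriv (a : ι → ℝ) : Derivation ℝ (MvPolynomial ι ℝ) (MvPolynomial ι ℝ) :=
  mkDerivation ℝ fun i => C (a i)

@[simp]
theorem dirDeriv_X (a : ι → ℝ) (i : ι) : dirDeriv a (X i) = C (a i) :=
  mkDerivation_X _ _ _

theorem dirDeriv_add (a b : ι → ℝ) : dirDeriv (a + b) = dirDeriv a + dirDeriv b := by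
  ext1 i; simp

theorem dirDeriv_smul (c : ℝ) (a : ι → ℝ) : dirDeriv (c • a) = c • dirDeriv a := by
  ext1 i; simp [smul_eq_C_mul]

theorem dirDeriv_sub (a b : ι → ℝ) : dirDeriv (a - b) = dirDeriv a - dirDeriv b := by
  ext1 i; simp

theorem dirDeriv_comm (a b : ι → ℝ) (P : MvPolynomial ι ℝ) :
    dirDeriv a (dirDeriv b P) = dirDeriv b (dirDeriv a P) := by
  have : ⁅dirDeriv a, dirDeriv b⁆ = 0 := by
    ext1 i
    simp [Derivation.commutator_apply]
  rw [← sub_eq_zero, ← Derivation.commutator_apply, this, Derivation.zero_apply]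

/-- The restriction of a polynomial to the complex line through `z` with direction `a`. -/
def line (z a : ι → ℂ) : MvPolynomial ι ℝ →ₐ[ℝ] Polynomial ℂ :=
  aeval fun i => Polynomial.C (z i) + Polynomial.C (a i) * Polynomial.X

theorem eval_line (z a : ι → ℂ) (t : ℂ) (P : MvPolynomial ι ℝ) :
    (line z a P).eval t = aeval (fun i => z i + a i * t) P := by
  induction P using MvPolynomial.induction_on with
  | C r => simp [line]
  | add p q hp hq => simp [hp, hq]
  | mul_X p i hp =>
    rw [map_mul, map_mul, Polynomial.eval_mul, hp]
    simp [line]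

theorem derivative_line (z : ι → ℂ) (a : ι → ℝ) (P : MvPolynomial ι ℝ) :
    (line z (fun i => a i) P).derivative = line z (fun i => a i) (dirDeriv a P) := by
  induction P using MvPolynomial.induction_on with
  | C r => simp [line]
  | add p q hp hq => simp [hp, hq]
  | mul_X p i hp =>
    simp only [map_mul, Polynomial.derivative_mul, hp, Derivation.leibniz, dirDeriv_X, smul_eq_mul,
      map_add]
    simp [line]
    ring

theorem aeval_ofReal (x : ι → ℝ) (P : MvPolynomial ι ℝ) :
    aeval (fun i => (x i : ℂ)) P = (eval x P : ℝ) := by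
  induction P using MvPolynomial.induction_on with
  | C r => simp
  | add p q hp hq => simp [hp, hq]
  | mul_X p i hp => simp [hp]

theorem aeval_conj (z : ι → ℂ) (P : MvPolynomial ι ℝ) :
    aeval (fun i => (starRingEnd ℂ) (z i)) P = (starRingEnd ℂ) (aeval z P) := by
  induction P using MvPolynomial.induction_on with
  | C r => simp
  | add p q hp hq => simp [hp, hq]
  | mul_X p i hp => simp [hp]

theorem eval_zero_line_ofReal (z b : ι → ℝ) (P : MvPolynomial ι ℝ) :
    (line (fun i => z i) (fun i => b i) P).eval 0 = (eval z P : ℝ) := by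
  simp [eval_line, aeval_ofReal]

theorem hasDerivAt_eval_add_smul (z c : ι → ℝ) (P : MvPolynomial ι ℝ) (t : ℝ) :
    HasDerivAt (fun t : ℝ => eval (z + t • c) P) (eval (z + t • c) (dirDeriv c P)) t := by
  induction P using MvPolynomial.induction_on with
  | C r => simpa using hasDerivAt_const t r
  | add p q hp hq => simpa using hp.fun_add hq
  | mul_X p i hp =>
    have h1 : HasDerivAt (fun t : ℝ => (z + t • c) i) (c i) t := by
      simpa using ((hasDerivAt_id t).mul_const (c i)).const_add (z i)
    have := hp.fun_mul h1
    simp only [map_mul, eval_X, Derivation.leibniz, dirDeriv_X, smul_eq_mul, map_add, eval_C]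
    exact this.congr_deriv (by ring)

/-- A real polynomial is stable if it has no zeros in the product of upper half-planes. -/
def Stable (P : MvPolynomial ι ℝ) : Prop :=
  ∀ z : ι → ℂ, (∀ i, 0 < (z i).im) → aeval z P ≠ 0

/-- The point `z` lies above the zeros of `P` if `P` is positive on the orthant based at `z`. -/
def Above (P : MvPolynomial ι ℝ) (z : ι → ℝ) : Prop :=
  ∀ y : ι → ℝ, 0 ≤ y → 0 < eval (z + y) P

theorem Above.pos {P : MvPolynomial ι ℝ} {z : ι → ℝ} (h : Above P z) : 0 < eval z P := by
  simpa using h 0 le_rfl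

theorem Above.add {P : MvPolynomial ι ℝ} {z y : ι → ℝ} (h : Above P z) (hy : 0 ≤ y) :
    Above P (z + y) := by
  intro x hx
  rw [add_assoc]
  exact h _ (add_nonneg hy hx)

theorem Stable.im_div_neg_or_eq_zero {P : MvPolynomial ι ℝ} (hP : Stable P) {a : ι → ℝ}
    (ha : 0 ≤ a) {z : ι → ℂ} (hz : ∀ i, 0 < (z i).im) :
    (aeval z (dirDeriv a P) / aeval z P).im < 0 ∨ aeval z (dirDeriv a P) / aeval z P = 0 := by
  have := Polynomial.im_logDeriv_neg_or_eq_zero (K := line z (fun i => a i) P) ?_ ?_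
  · simpa [derivative_line, eval_line] using this
  · intro τ hτ
    by_contra! hc
    rw [eval_line] at hτ
    refine hP _ (fun i => ?_) hτ
    simp only [add_im, mul_im, ofReal_re, ofReal_im, zero_mul, add_zero]
    exact add_pos_of_pos_of_nonneg (hz i) (mul_nonneg (ha i) hc)
  · simpa [eval_line] using hP z hz

theorem Stable.im_div_nonpos {P : MvPolynomial ι ℝ} (hP : Stable P) {a : ι → ℝ}
    (ha : 0 ≤ a) {z : ι → ℂ} (hz : ∀ i, 0 < (z i).im) :
    (aeval z (dirDeriv a P) / aeval z P).im ≤ 0 := by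
  rcases hP.im_div_neg_or_eq_zero ha hz with h | h
  · exact h.le
  · simp [h]

theorem Stable.sub_dirDeriv {P : MvPolynomial ι ℝ} (hP : Stable P) {a : ι → ℝ} (ha : 0 ≤ a) :
    Stable (P - dirDeriv a P) := by
  intro z hz hc
  have h0 := hP z hz
  have h1 : aeval z (dirDeriv a P) / aeval z P = 1 := by
    rw [div_eq_one_iff_eq h0]
    rw [map_sub, sub_eq_zero] at hc
    exact hc.symm
  rcases hP.im_div_neg_or_eq_zero ha hz with h | h <;> simp [h1] at h

theorem Stable.root_line {P : MvPolynomial ι ℝ} (hP : Stable P) {z b : ι → ℝ} (hz : Above P z)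
    (hb : ∀ i, 0 < b i) {τ : ℂ} (hτ : (line (fun i => z i) (fun i => b i) P).eval τ = 0) :
    τ.im = 0 ∧ τ.re < 0 := by
  have hmain : ∀ τ : ℂ, (line (fun i => z i) (fun i => b i) P).eval τ = 0 → τ.im ≤ 0 := by
    intro τ hτ
    by_contra! hc
    rw [eval_line] at hτ
    refine hP _ (fun i => ?_) hτ
    simpa using mul_pos (hb i) hc
  have h1 : τ.im = 0 := by
    apply le_antisymm (hmain τ hτ)
    have := hmain ((starRingEnd ℂ) τ) (by
      rw [eval_line] at hτ ⊢
      have := aeval_conj (fun i => (z i : ℂ) + b i * τ) P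
      simpa [hτ] using this)
    simpa using this
  refine ⟨h1, ?_⟩
  by_contra! hc
  have h2 : τ = (τ.re : ℂ) := by apply Complex.ext <;> simp [h1]
  have h3 := hz (τ.re • b) (smul_nonneg hc fun i => (hb i).le)
  rw [eval_line, h2] at hτ
  have h4 := aeval_ofReal (z + τ.re • b) P
  simp only [Pi.add_apply, Pi.smul_apply, smul_eq_mul, ofReal_add, ofReal_mul] at h4
  simp only [mul_comm] at hτ
  rw [hτ] at h4
  exact h3.ne (by exact_mod_cast h4)

theorem Stable.eval_dirDeriv_nonneg {P : MvPolynomial ι ℝ} (hP : Stable P) {z a : ι → ℝ}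
    (hz : Above P z) (ha : 0 ≤ a) : 0 ≤ eval z (dirDeriv a P) := by
  have key : ∀ η : ℝ, 0 < η → 0 ≤ eval z (dirDeriv (a + η • (1 : ι → ℝ)) P) := by
    intro η hη
    have hpos : ∀ i, 0 < (a + η • (1 : ι → ℝ)) i := fun i => by
      simpa using add_pos_of_nonneg_of_pos (ha i) hη
    have := Polynomial.re_logDeriv_nonneg
      (K := line (fun i => z i) (fun i => ((a + η • (1 : ι → ℝ)) i : ℝ)) P)
      (fun τ hτ => (hP.root_line hz hpos hτ).2.le) (by
        rw [eval_zero_line_ofReal]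
        exact_mod_cast hz.pos.ne')
    rw [derivative_line, eval_zero_line_ofReal, eval_zero_line_ofReal, ← ofReal_div,
      ofReal_re] at this
    by_contra! hc
    exact (div_neg_of_neg_of_pos hc hz.pos).not_ge this
  simp only [dirDeriv_add, dirDeriv_smul, Derivation.add_apply, Derivation.smul_apply, map_add,
    smul_eval] at key
  refine ge_of_tendsto (x := nhdsWithin (0 : ℝ) (Set.Ioi 0)) (Filter.Tendsto.mono_left ?_
    nhdsWithin_le_nhds) (Filter.mem_of_superset self_mem_nhdsWithin fun η hη => key η hη)
  refine Continuous.tendsto' (by fun_prop) _ _ ?_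
  simp

variable [Finite ι]

theorem Stable.signs_of_pos {P : MvPolynomial ι ℝ} (hP : Stable P) {z a b : ι → ℝ}
    (hz : Above P z) (ha : ∀ i, 0 < a i) (hb : ∀ i, 0 < b i) :
    eval z (dirDeriv b (dirDeriv a P)) * eval z P
      - eval z (dirDeriv a P) * eval z (dirDeriv b P) ≤ 0
    ∧ 0 ≤ eval z P * (eval z P * (eval z (dirDeriv b (dirDeriv b (dirDeriv a P))) * eval z P
        + eval z (dirDeriv b (dirDeriv b P)) * eval z (dirDeriv a P)
        - 2 * eval z (dirDeriv b P) * eval z (dirDeriv b (dirDeriv a P)))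
        - 2 * eval z (dirDeriv a P) *
          (eval z (dirDeriv b (dirDeriv b P)) * eval z P - eval z (dirDeriv b P) ^ 2)) := by
  classical
  cases nonempty_fintype ι
  obtain ⟨c, hc0, hc⟩ : ∃ c : ℝ, 0 ≤ c ∧ ∀ i, a i ≤ c * b i := by
    refine ⟨∑ i, a i / b i, Finset.sum_nonneg fun i _ => (div_pos (ha i) (hb i)).le, fun i => ?_⟩
    rw [← div_le_iff₀ (hb i)]
    exact Finset.single_le_sum (f := fun i => a i / b i)
      (fun i _ => (div_pos (ha i) (hb i)).le) (Finset.mem_univ i)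
  have hne : line (fun i => (z i : ℂ)) (fun i => (b i : ℂ)) P ≠ 0 := by
    intro h0
    have := eval_zero_line_ofReal z b P
    rw [h0, Polynomial.eval_zero] at this
    exact hz.pos.ne (by exact_mod_cast this)
  obtain ⟨B, hB0, hB⟩ := Polynomial.exists_norm_logDeriv_le hne
    fun τ hτ => (hP.root_line hz hb hτ).2
  have him : ∀ t : ℂ, 0 < t.im → ∀ i, 0 < ((z i : ℂ) + b i * t).im := by
    intro t ht i
    simpa using mul_pos (hb i) ht
  refine Polynomial.logDeriv_signs (B := c * B) (fun τ hτ => hP.root_line hz hb hτ) ?_ ?_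
    (eval_zero_line_ofReal z b P) (by rw [derivative_line, eval_zero_line_ofReal])
    (by rw [derivative_line, derivative_line, eval_zero_line_ofReal])
    (eval_zero_line_ofReal z b (dirDeriv a P)) (by rw [derivative_line, eval_zero_line_ofReal])
    (by rw [derivative_line, derivative_line, eval_zero_line_ofReal])
  · intro t ht
    rw [eval_line, eval_line]
    exact hP.im_div_nonpos (fun i => (ha i).le) (him t ht)
  · intro t htr hti
    have hconj : ∀ Q : MvPolynomial ι ℝ, (line (fun i => (z i : ℂ)) (fun i => (b i : ℂ)) Q).eval t
        = (starRingEnd ℂ)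
          ((line (fun i => (z i : ℂ)) (fun i => (b i : ℂ)) Q).eval ((starRingEnd ℂ) t)) := by
      intro Q
      rw [eval_line, eval_line, ← aeval_conj]
      simp
    rcases hti.lt_or_eq with hti | hti
    · rw [hconj, hconj P, ← map_div₀, conj_im]
      set s := (starRingEnd ℂ) t
      have hs : 0 < s.im := by simpa [s] using hti
      have hcb : (0 : ι → ℝ) ≤ c • b - a := fun i => by simpa using hc i
      have h1 := hP.im_div_nonpos hcb (him s hs)
      rw [dirDeriv_sub, dirDeriv_smul, Derivation.sub_apply, Derivation.smul_apply, map_sub,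
        map_smul, sub_div, sub_im, real_smul, mul_div_assoc, im_ofReal_mul] at h1
      have hs' : 0 ≤ s.re := by simpa [s] using htr
      have h2 := (hB s hs').trans (div_le_self hB0 (by linarith))
      rw [derivative_line, eval_line, eval_line] at h2
      rw [eval_line, eval_line]
      have h3 := (neg_le_abs _).trans ((abs_im_le_norm _).trans h2)
      nlinarith [mul_le_mul_of_nonneg_left h3 hc0]
    · have h1 : (starRingEnd ℂ) t = t := conj_eq_iff_im.2 hti
      have h2 := congrArg im (hconj (dirDeriv a P))
      have h3 : ((line (fun i => (z i : ℂ)) (fun i => (b i : ℂ)) (dirDeriv a P)).eval t /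
        (line (fun i => (z i : ℂ)) (fun i => (b i : ℂ)) P).eval t).im = 0 := by
        rw [← conj_eq_iff_im, map_div₀]
        conv_rhs => rw [hconj, hconj P, h1]
      rw [h3]
      positivity

theorem Stable.signs {P : MvPolynomial ι ℝ} (hP : Stable P) {z a b : ι → ℝ}
    (hz : Above P z) (ha : 0 ≤ a) (hb : 0 ≤ b) :
    eval z (dirDeriv b (dirDeriv a P)) * eval z P
      - eval z (dirDeriv a P) * eval z (dirDeriv b P) ≤ 0
    ∧ 0 ≤ eval z P * (eval z P * (eval z (dirDeriv b (dirDeriv b (dirDeriv a P))) * eval z P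
        + eval z (dirDeriv b (dirDeriv b P)) * eval z (dirDeriv a P)
        - 2 * eval z (dirDeriv b P) * eval z (dirDeriv b (dirDeriv a P)))
        - 2 * eval z (dirDeriv a P) *
          (eval z (dirDeriv b (dirDeriv b P)) * eval z P - eval z (dirDeriv b P) ^ 2)) := by
  have hpos : ∀ (c : ι → ℝ) (_ : 0 ≤ c) (η : ℝ) (_ : 0 < η) i, 0 < (c + η • (1 : ι → ℝ)) i := by
    intro c hc η hη i
    simpa using add_pos_of_nonneg_of_pos (hc i) hη
  have key := fun (η : ℝ) (hη : 0 < η) => hP.signs_of_pos hz (hpos a ha η hη) (hpos b hb η hη)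
  simp only [dirDeriv_add, dirDeriv_smul, Derivation.add_apply, Derivation.smul_apply, map_add,
    smul_eval, Derivation.map_smul] at key
  constructor
  · refine le_of_tendsto (x := nhdsWithin (0 : ℝ) (Set.Ioi 0)) (Filter.Tendsto.mono_left ?_
      nhdsWithin_le_nhds) (Filter.mem_of_superset self_mem_nhdsWithin fun η hη => (key η hη).1)
    refine Continuous.tendsto' (by fun_prop) _ _ ?_
    simp
  · refine ge_of_tendsto (x := nhdsWithin (0 : ℝ) (Set.Ioi 0)) (Filter.Tendsto.mono_left ?_
      nhdsWithin_le_nhds) (Filter.mem_of_superset self_mem_nhdsWithin fun η hη => (key η hη).2)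
    refine Continuous.tendsto' (by fun_prop) _ _ ?_
    simp

end MvPolynomial

/-! ### The barrier function -/

namespace MvPolynomial

open Complex

variable {ι : Type*}

/-- The barrier function of `P` in direction `a`. -/
def barrier (P : MvPolynomial ι ℝ) (a z : ι → ℝ) : ℝ :=
  eval z (dirDeriv a P) / eval z P

theorem continuous_eval_add_smul (z c : ι → ℝ) (P : MvPolynomial ι ℝ) :
    Continuous fun t : ℝ => eval (z + t • c) P :=
  continuous_iff_continuousAt.2 fun t => (hasDerivAt_eval_add_smul z c P t).continuousAt

theorem Above.add_smul {P : MvPolynomial ι ℝ} {z c : ι → ℝ} (hz : Above P z) (hc : 0 ≤ c) {t : ℝ}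
    (ht : 0 ≤ t) : Above P (z + t • c) :=
  hz.add (smul_nonneg ht hc)

theorem Stable.barrier_nonneg {P : MvPolynomial ι ℝ} (hP : Stable P) {z a : ι → ℝ}
    (hz : Above P z) (ha : 0 ≤ a) : 0 ≤ barrier P a z :=
  div_nonneg (hP.eval_dirDeriv_nonneg hz ha) hz.pos.le

theorem hasDerivAt_barrier {P : MvPolynomial ι ℝ} {z a c : ι → ℝ} {t : ℝ}
    (hz : eval (z + t • c) P ≠ 0) :
    HasDerivAt (fun t : ℝ => barrier P a (z + t • c))
      ((eval (z + t • c) (dirDeriv c (dirDeriv a P)) * eval (z + t • c) P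
        - eval (z + t • c) (dirDeriv a P) * eval (z + t • c) (dirDeriv c P))
        / eval (z + t • c) P ^ 2) t :=
  (hasDerivAt_eval_add_smul z c (dirDeriv a P) t).fun_div (hasDerivAt_eval_add_smul z c P t) hz

variable [Finite ι] {P : MvPolynomial ι ℝ} {z a c : ι → ℝ}

theorem Stable.deriv_barrier_nonpos (hP : Stable P) (hz : Above P z) (ha : 0 ≤ a) (hc : 0 ≤ c) :
    (eval z (dirDeriv c (dirDeriv a P)) * eval z P
        - eval z (dirDeriv a P) * eval z (dirDeriv c P)) / eval z P ^ 2 ≤ 0 :=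
  div_nonpos_of_nonpos_of_nonneg (hP.signs hz ha hc).1 (sq_nonneg _)

theorem Stable.barrier_add_le (hP : Stable P) (hz : Above P z) (ha : 0 ≤ a) (hc : 0 ≤ c) :
    barrier P a (z + c) ≤ barrier P a z := by
  have hd : ∀ t : ℝ, 0 ≤ t → _ := fun t ht =>
    hasDerivAt_barrier (P := P) (z := z) (a := a) (c := c) (t := t) (hz.add_smul hc ht).pos.ne'
  have h := antitoneOn_of_deriv_nonpos (convex_Ici (0 : ℝ))
    (f := fun t : ℝ => barrier P a (z + t • c))
    (fun t ht => (hd t ht).continuousAt.continuousWithinAt)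
    (fun t ht => (hd t (interior_subset ht)).differentiableAt.differentiableWithinAt)
    (fun t ht => by
      rw [(hd t (interior_subset ht)).deriv]
      exact hP.deriv_barrier_nonpos (hz.add_smul hc (interior_subset ht)) ha hc)
  simpa using h (Set.mem_Ici.2 le_rfl) (Set.mem_Ici.2 zero_le_one) zero_le_one

/-- Convexity of the barrier function, in the form of a tangent line inequality. -/
theorem Stable.barrier_sub_le (hP : Stable P) (hz : Above P z) (ha : 0 ≤ a) (hc : 0 ≤ c) {δ : ℝ}
    (hδ : 0 < δ) :
    barrier P a (z + δ • c) - δ * ((eval (z + δ • c) (dirDeriv c (dirDeriv a P))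
        * eval (z + δ • c) P - eval (z + δ • c) (dirDeriv a P) * eval (z + δ • c) (dirDeriv c P))
        / eval (z + δ • c) P ^ 2) ≤ barrier P a z := by
  set F' : ℝ → ℝ := fun t => ((eval (z + t • c) (dirDeriv c (dirDeriv a P))
        * eval (z + t • c) P - eval (z + t • c) (dirDeriv a P) * eval (z + t • c) (dirDeriv c P))
        / eval (z + t • c) P ^ 2) with hF'
  have hd : ∀ t : ℝ, 0 ≤ t → HasDerivAt (fun t : ℝ => barrier P a (z + t • c)) (F' t) t :=
    fun t ht => hasDerivAt_barrier (hz.add_smul hc ht).pos.ne'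
  have hd2 : ∀ t : ℝ, 0 ≤ t → ∃ s : ℝ, 0 ≤ s ∧ HasDerivAt F' s t := by
    intro t ht
    have hp := (hz.add_smul hc ht).pos
    have h2 := (hP.signs (hz.add_smul hc ht) ha hc).2
    refine ⟨_, ?_, (((hasDerivAt_eval_add_smul z c (dirDeriv c (dirDeriv a P)) t).fun_mul
      (hasDerivAt_eval_add_smul z c P t)).fun_sub
      ((hasDerivAt_eval_add_smul z c (dirDeriv a P) t).fun_mul
      (hasDerivAt_eval_add_smul z c (dirDeriv c P) t))).fun_div
      ((hasDerivAt_eval_add_smul z c P t).fun_pow 2) (pow_ne_zero 2 hp.ne')⟩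
    apply div_nonneg _ (sq_nonneg _)
    refine h2.trans_eq ?_
    push_cast
    ring
  have hmono : MonotoneOn F' (Set.Ici 0) := by
    refine monotoneOn_of_deriv_nonneg (convex_Ici (0 : ℝ)) (fun t ht => ?_) (fun t ht => ?_)
      (fun t ht => ?_)
    · obtain ⟨s, -, h⟩ := hd2 t ht
      exact h.continuousAt.continuousWithinAt
    · obtain ⟨s, -, h⟩ := hd2 t (interior_subset ht)
      exact h.differentiableAt.differentiableWithinAt
    · obtain ⟨s, hs, h⟩ := hd2 t (interior_subset ht)
      rwa [h.deriv]
  obtain ⟨ξ, hξ, h⟩ := exists_hasDerivAt_eq_slope (fun t : ℝ => barrier P a (z + t • c)) F' hδ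
    (fun t ht => (hd t ht.1).continuousAt.continuousWithinAt) (fun t ht => hd t ht.1.le)
  have h1 : F' ξ ≤ F' δ := hmono hξ.1.le hδ.le hξ.2.le
  rw [sub_zero, eq_div_iff hδ.ne', zero_smul, add_zero] at h
  change _ - δ * F' δ ≤ _
  nlinarith

theorem Stable.above_sub_dirDeriv (hP : Stable P) (hz : Above P z) (hc : 0 ≤ c)
    (hb : barrier P c z < 1) : Above (P - dirDeriv c P) z := by
  intro y hy
  have h1 := (hP.barrier_add_le hz hc hy).trans_lt hb
  rw [barrier, div_lt_one (hz y hy)] at h1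
  rw [map_sub]
  linarith

/-- The barrier step: applying `1 - ∂_c` and moving by `δ` in direction `c` does not increase the
barrier functions. -/
theorem Stable.barrier_step (hP : Stable P) (hz : Above P z) (hc : 0 ≤ c) {δ : ℝ} (hδ : 0 < δ)
    (hb : barrier P c z ≤ 1 - 1 / δ) :
    Above (P - dirDeriv c P) (z + δ • c) ∧
      ∀ a : ι → ℝ, 0 ≤ a → barrier (P - dirDeriv c P) a (z + δ • c) ≤ barrier P a z := by
  have hδ' : 0 < 1 / δ := one_div_pos.2 hδ
  refine ⟨(hP.above_sub_dirDeriv hz hc (by linarith)).add_smul hc hδ.le, fun a ha => ?_⟩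
  have hw := hz.add_smul hc hδ.le
  refine le_trans ?_ (hP.barrier_sub_le hz ha hc hδ)
  have h1 := (hP.barrier_add_le hz hc (smul_nonneg hδ.le hc)).trans hb
  have h2 := (hP.signs hw ha hc).1
  have hp := hw.pos
  rw [barrier, map_sub, map_sub, map_sub, dirDeriv_comm a c, barrier]
  rw [barrier] at h1
  set w := z + δ • c
  generalize eval w P = p at *
  generalize eval w (dirDeriv c P) = q at *
  generalize eval w (dirDeriv a P) = r at *
  generalize eval w (dirDeriv c (dirDeriv a P)) = s at *
  rw [div_le_iff₀ hp, sub_mul, one_mul, ← sub_nonneg] at h1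
  have h3 : 0 < p - q := by nlinarith [mul_pos hδ' hp]
  have h4 : p ≤ δ * (p - q) := by
    have := mul_le_mul_of_nonneg_left (sub_nonneg.1 h1) hδ.le
    rw [mul_sub, ← mul_assoc, mul_one_div_cancel hδ.ne'] at this
    linarith
  have h5 : (r - s) / (p - q) = r / p - (s * p - r * q) / (p * (p - q)) := by
    field_simp
    ring
  rw [h5]
  have h6 : δ * ((s * p - r * q) / p ^ 2) ≤ (s * p - r * q) / (p * (p - q)) := by
    rw [mul_div_assoc', div_le_div_iff₀ (by positivity) (by positivity)]
    have := mul_le_mul_of_nonpos_left h4 h2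
    nlinarith
  linarith

theorem Stable.exists_above_sub_smul (hP : Stable P) (hz : Above P z) :
    ∃ η : ℝ, 0 < η ∧ Above P (z - η • (1 : ι → ℝ)) := by
  have h1 : (0 : ι → ℝ) ≤ 1 := zero_le_one
  set B := barrier P 1 z
  have hB : 0 ≤ B := hP.barrier_nonneg hz h1
  refine ⟨1 / (B + 1), by positivity, fun y hy => ?_⟩
  have hw : Above P (z + y) := hz.add hy
  have hwB : barrier P 1 (z + y) ≤ B := hP.barrier_add_le hz h1 hy
  have hroot : ∀ s : ℝ, eval (z + y + s • (1 : ι → ℝ)) P = 0 → s < -(1 / (B + 1)) := by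
    intro s hs
    set K := line (fun i => ((z + y) i : ℂ)) (fun i => ((1 : ι → ℝ) i : ℂ)) P with hK
    have hr : ∀ τ, K.eval τ = 0 → τ.im = 0 ∧ τ.re < 0 := fun τ hτ =>
      hP.root_line hw (fun i => by simp) hτ
    have h0 : K.eval 0 ≠ 0 := by
      rw [hK, eval_zero_line_ofReal]
      exact_mod_cast hw.pos.ne'
    have hs' : K.eval (s : ℂ) = 0 := by
      rw [hK, eval_line]
      have := aeval_ofReal (z + y + s • (1 : ι → ℝ)) P
      rw [hs] at this
      simpa using this
    have h2 := Polynomial.neg_inv_re_le_logDeriv hr h0 hs'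
    have h3 := (hr _ hs').2
    rw [hK, derivative_line, eval_zero_line_ofReal, eval_zero_line_ofReal, ← ofReal_div,
      ofReal_re, ofReal_re] at h2
    rw [ofReal_re] at h3
    have h4 : -s⁻¹ < B + 1 := (h2.trans hwB).trans_lt (lt_add_one B)
    rw [lt_neg, one_div, inv_lt_comm₀ (by positivity) (by linarith), inv_neg]
    exact h4
  have hpos : (0 : ℝ) < 1 / (B + 1) := by positivity
  have e : z - (1 / (B + 1)) • (1 : ι → ℝ) + y = z + y + (-(1 / (B + 1))) • (1 : ι → ℝ) := by
    rw [neg_smul]; abel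
  rw [e]
  by_contra! hneg
  obtain ⟨s, hs, hs0⟩ := intermediate_value_Icc (neg_nonpos.2 hpos.le)
    (continuous_eval_add_smul (z + y) 1 P).continuousOn
    (show (0 : ℝ) ∈ _ from ⟨hneg, by simpa using hw.pos.le⟩)
  exact (hroot s hs0).not_ge hs.1

/-- Positivity of `P - ∂_c P` along a diagonal ray forces positivity of `P` on an orthant. -/
theorem Stable.above_of_ray (hP : Stable P) (hc : 0 ≤ c) {y : ℝ}
    (hray : ∀ x : ℝ, y ≤ x → 0 < eval (x • (1 : ι → ℝ)) (P - dirDeriv c P))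
    (hex : ∃ x : ℝ, Above P (x • (1 : ι → ℝ))) : Above P (y • (1 : ι → ℝ)) := by
  have h1 : (0 : ι → ℝ) ≤ 1 := zero_le_one
  have hup : ∀ x x' : ℝ, x ≤ x' → Above P (x • (1 : ι → ℝ)) → Above P (x' • (1 : ι → ℝ)) := by
    intro x x' hx hA
    have := hA.add_smul h1 (sub_nonneg.2 hx)
    rwa [← add_smul, add_sub_cancel] at this
  set S : Set ℝ := {x | y ≤ x ∧ Above P (x • (1 : ι → ℝ))}
  have hne : S.Nonempty := by
    obtain ⟨x, hx⟩ := hex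
    exact ⟨max x y, le_max_right _ _, hup _ _ (le_max_left _ _) hx⟩
  have hbdd : BddBelow S := ⟨y, fun x hx => hx.1⟩
  set l := sInf S
  have hyl : y ≤ l := le_csInf hne fun x hx => hx.1
  have hgt : ∀ t : ℝ, 0 < t → Above P (l • (1 : ι → ℝ) + t • 1) := by
    intro t ht
    obtain ⟨x, hx, hxt⟩ := exists_lt_of_csInf_lt hne (show sInf S < l + t by linarith)
    rw [← add_smul]
    exact hup _ _ hxt.le hx.2
  have hlim : ∀ (v : ι → ℝ) (Q : MvPolynomial ι ℝ), Filter.Tendsto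
      (fun t : ℝ => eval (v + t • (1 : ι → ℝ)) Q) (nhdsWithin 0 (Set.Ioi 0)) (nhds (eval v Q)) := by
    intro v Q
    have := ((continuous_eval_add_smul v 1 Q).tendsto 0).mono_left
      (nhdsWithin_le_nhds (s := Set.Ioi (0 : ℝ)))
    simpa using this
  have hpos : 0 < eval (l • (1 : ι → ℝ)) P := by
    have h2 := ge_of_tendsto (hlim (l • 1) (dirDeriv c P))
      (Filter.mem_of_superset self_mem_nhdsWithin fun t ht =>
        hP.eval_dirDeriv_nonneg (hgt t ht) hc)
    have h3 := hray l hyl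
    rw [map_sub] at h3
    linarith
  have hl : Above P (l • (1 : ι → ℝ)) := by
    intro v hv
    have hA : ∀ t : ℝ, 0 < t → Above P (l • (1 : ι → ℝ) + v + t • 1) := by
      intro t ht
      rw [add_right_comm]
      exact (hgt t ht).add hv
    have hd : ∀ t : ℝ, 0 < t → _ := fun t ht =>
      (hasDerivAt_eval_add_smul (l • 1 + v) 1 P t).fun_div
        (hasDerivAt_eval_add_smul (l • 1) 1 P t) (hgt t ht).pos.ne'
    have hanti := antitoneOn_of_deriv_nonpos (convex_Ioi (0 : ℝ))
      (f := fun t : ℝ => eval (l • (1 : ι → ℝ) + v + t • 1) P / eval (l • (1 : ι → ℝ) + t • 1) P)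
      (fun t ht => (hd t ht).continuousAt.continuousWithinAt)
      (fun t ht => (hd t (interior_subset ht)).differentiableAt.differentiableWithinAt)
      (fun t ht => by
        replace ht : 0 < t := interior_subset ht
        rw [(hd t ht).deriv]
        apply div_nonpos_of_nonpos_of_nonneg _ (sq_nonneg _)
        have h4 := hP.barrier_add_le (hgt t ht) h1 hv
        rw [← add_right_comm, barrier, barrier, div_le_div_iff₀ (hA t ht).pos (hgt t ht).pos] at h4
        linarith)
    set q := eval (l • (1 : ι → ℝ) + v + (1 : ℝ) • 1) P / eval (l • (1 : ι → ℝ) + (1 : ℝ) • 1) P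
    have hq : 0 < q := div_pos (hA 1 one_pos).pos (hgt 1 one_pos).pos
    have h5 : ∀ᶠ t : ℝ in nhdsWithin 0 (Set.Ioi 0), q * eval (l • (1 : ι → ℝ) + t • 1) P
        ≤ eval (l • (1 : ι → ℝ) + v + t • 1) P := by
      filter_upwards [Ioo_mem_nhdsGT (one_pos : (0 : ℝ) < 1)] with t ht
      rw [← le_div_iff₀ (hgt t ht.1).pos]
      exact hanti (Set.mem_Ioi.2 ht.1) (Set.mem_Ioi.2 one_pos) ht.2.le
    have h6 := le_of_tendsto_of_tendsto ((hlim (l • 1) P).const_mul q) (hlim (l • 1 + v) P) h5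
    exact (mul_pos hq hpos).trans_le h6
  rcases hyl.lt_or_eq with hlt | heq
  · obtain ⟨η, hη, hA⟩ := hP.exists_above_sub_smul hl
    rw [← sub_smul] at hA
    have hmem : max (l - η) y ∈ S := ⟨le_max_right _ _, hup _ _ (le_max_left _ _) hA⟩
    have := csInf_le hbdd hmem
    exact absurd this (not_le.2 (max_lt (by linarith) hlt))
  · rwa [heq]

/-- Applying `1 - ∂_c` preserves positivity on orthants based far out on the diagonal. -/
theorem Stable.exists_above_sub_dirDeriv (hP : Stable P) (hc : 0 ≤ c)
    (hex : ∃ x : ℝ, Above P (x • (1 : ι → ℝ))) :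
    ∃ x : ℝ, Above (P - dirDeriv c P) (x • (1 : ι → ℝ)) := by
  classical
  cases nonempty_fintype ι
  have h1 : (0 : ι → ℝ) ≤ 1 := zero_le_one
  obtain ⟨x, hx⟩ := hex
  obtain ⟨M, hM0, hM⟩ : ∃ M : ℝ, 0 ≤ M ∧ ∀ i, c i ≤ M :=
    ⟨∑ i, c i, Finset.sum_nonneg fun i _ => hc i,
      fun i => Finset.single_le_sum (fun i _ => hc i) (Finset.mem_univ i)⟩
  set K := line (fun i => ((x • (1 : ι → ℝ)) i : ℂ)) (fun i => ((1 : ι → ℝ) i : ℂ)) P with hK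
  have hev : ∀ (Q : MvPolynomial ι ℝ) (t : ℝ),
      (line (fun i => ((x • (1 : ι → ℝ)) i : ℂ)) (fun i => ((1 : ι → ℝ) i : ℂ)) Q).eval (t : ℂ)
        = (eval (x • (1 : ι → ℝ) + t • 1) Q : ℝ) := by
    intro Q t
    rw [eval_line, ← aeval_ofReal]
    simp
  have hne : K ≠ 0 := by
    intro h0
    have h2 := hev P 0
    rw [← hK, h0, Polynomial.eval_zero] at h2
    exact (hx.add_smul h1 le_rfl).pos.ne (by exact_mod_cast h2)
  obtain ⟨B, hB0, hB⟩ := Polynomial.exists_norm_logDeriv_le hne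
    fun τ hτ => (hP.root_line hx (fun i => by simp) hτ).2
  refine ⟨x + M * B, ?_⟩
  have ht : 0 ≤ M * B := mul_nonneg hM0 hB0
  have hA := hx.add_smul h1 ht
  rw [add_smul]
  refine hP.above_sub_dirDeriv hA hc ?_
  have h2 := hB ((M * B : ℝ) : ℂ) (by rw [ofReal_re]; exact ht)
  rw [hK, derivative_line, hev, hev, ← ofReal_div, ofReal_re, norm_real] at h2
  have h3 := (le_abs_self _).trans h2
  have h4 : (0 : ι → ℝ) ≤ M • 1 - c := fun i => by simpa using hM i
  have h5 := hP.barrier_nonneg hA h4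
  rw [barrier, dirDeriv_sub, dirDeriv_smul, Derivation.sub_apply, Derivation.smul_apply, map_sub,
    smul_eval, sub_div, mul_div_assoc] at h5
  rw [le_div_iff₀ (by linarith)] at h3
  rw [barrier]
  set φ := eval (x • (1 : ι → ℝ) + (M * B) • 1) (dirDeriv 1 P)
    / eval (x • (1 : ι → ℝ) + (M * B) • 1) P
  by_contra! hcon
  have h6 : 1 ≤ M * φ := by linarith
  have h7 := mul_le_mul_of_nonneg_left h3 hM0
  nlinarith

end MvPolynomial

/-! ### Iterated operators `1 - ∂_c` -/

namespace MvPolynomial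

variable {ι : Type*}

/-- The composition of the operators `1 - ∂_c` for `c` in the list `l`, applied to `P`. -/
def subDerivs (l : List (ι → ℝ)) (P : MvPolynomial ι ℝ) : MvPolynomial ι ℝ :=
  l.foldr (fun c Q => Q - dirDeriv c Q) P

@[simp]
theorem subDerivs_nil (P : MvPolynomial ι ℝ) : subDerivs [] P = P := rfl

theorem subDerivs_cons (c : ι → ℝ) (l : List (ι → ℝ)) (P : MvPolynomial ι ℝ) :
    subDerivs (c :: l) P = subDerivs l P - dirDeriv c (subDerivs l P) := rfl

theorem subDerivs_sub_dirDeriv (c : ι → ℝ) (l : List (ι → ℝ)) (P : MvPolynomial ι ℝ) :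
    subDerivs l (P - dirDeriv c P) = subDerivs l P - dirDeriv c (subDerivs l P) := by
  induction l with
  | nil => rfl
  | cons a l ih =>
    simp only [subDerivs_cons, ih, map_sub, dirDeriv_comm a c]
    abel

theorem Stable.subDerivs {P : MvPolynomial ι ℝ} (hP : Stable P) {l : List (ι → ℝ)}
    (hl : ∀ c ∈ l, 0 ≤ c) : Stable (subDerivs l P) := by
  induction l with
  | nil => exact hP
  | cons a l ih => exact (ih fun c hc => hl c (by simp [hc])).sub_dirDeriv (hl a (by simp))

theorem eval_sub_dirDeriv {P : MvPolynomial ι ℝ} {a : ι → ℝ}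
    (h : dirDeriv a (dirDeriv a P) = 0) (z : ι → ℝ) :
    eval z (P - dirDeriv a P) = eval (z - a) P := by
  have h1 : ∀ t : ℝ, HasDerivAt (fun t : ℝ => eval (z + t • a) (dirDeriv a P)) 0 t := fun t => by
    simpa [h] using hasDerivAt_eval_add_smul z a (dirDeriv a P) t
  have h2 : ∀ t : ℝ, HasDerivAt
      (fun t : ℝ => eval (z + t • a) P - t * eval (z + t • a) (dirDeriv a P)) 0 t := fun t => by
    exact ((hasDerivAt_eval_add_smul z a P t).fun_sub
      ((hasDerivAt_id t).fun_mul (h1 t))).congr_deriv (by simp)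
  have e1 := is_const_of_deriv_eq_zero (fun t => (h1 t).differentiableAt) (fun t => (h1 t).deriv)
    0 (-1)
  have e2 := is_const_of_deriv_eq_zero (fun t => (h2 t).differentiableAt) (fun t => (h2 t).deriv)
    0 (-1)
  simp only [zero_smul, add_zero, neg_smul, one_smul, ← sub_eq_add_neg] at e1 e2
  rw [map_sub]
  linarith

theorem eval_subDerivs {P : MvPolynomial ι ℝ} {l : List (ι → ℝ)}
    (h : ∀ a ∈ l, dirDeriv a (dirDeriv a P) = 0) (z : ι → ℝ) :
    eval z (subDerivs l P) = eval (z - l.sum) P := by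
  induction l generalizing P z with
  | nil => simp
  | cons c l ih =>
    rw [subDerivs_cons, ← subDerivs_sub_dirDeriv, ih, eval_sub_dirDeriv (h c (by simp)),
      List.sum_cons, sub_sub, add_comm]
    intro a ha
    have h0 := h a (by simp [ha])
    rw [map_sub, map_sub, dirDeriv_comm a c, dirDeriv_comm a c, h0, map_zero, sub_zero]

theorem dirDeriv_sum {σ : Type*} (s : Finset σ) (a : σ → ι → ℝ) (P : MvPolynomial ι ℝ) :
    dirDeriv (∑ j ∈ s, a j) P = ∑ j ∈ s, dirDeriv (a j) P := by
  classical
  induction s using Finset.induction_on with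
  | empty =>
    have := dirDeriv_smul 0 (0 : ι → ℝ)
    rw [zero_smul, zero_smul] at this
    simp [this]
  | insert j s hj ih =>
    rw [Finset.sum_insert hj, Finset.sum_insert hj, dirDeriv_add, Derivation.add_apply, ih]

variable [Finite ι]

theorem Stable.exists_above_subDerivs {P : MvPolynomial ι ℝ} (hP : Stable P) {l : List (ι → ℝ)}
    (hl : ∀ c ∈ l, 0 ≤ c) (hex : ∃ x : ℝ, Above P (x • (1 : ι → ℝ))) :
    ∃ x : ℝ, Above (MvPolynomial.subDerivs l P) (x • (1 : ι → ℝ)) := by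
  induction l with
  | nil => exact hex
  | cons a l ih =>
    have h0 : ∀ c ∈ l, 0 ≤ c := fun c hc => hl c (by simp [hc])
    exact (hP.subDerivs h0).exists_above_sub_dirDeriv (hl a (by simp)) (ih h0)

theorem Stable.above_subDerivs {P : MvPolynomial ι ℝ} (hP : Stable P) {z : ι → ℝ}
    (hz : Above P z) {δ : ℝ} (hδ : 0 < δ) {l : List (ι → ℝ)} (hl : ∀ c ∈ l, 0 ≤ c)
    (hb : ∀ c ∈ l, barrier P c z ≤ 1 - 1 / δ) :
    Above (MvPolynomial.subDerivs l P) (z + δ • l.sum) ∧ ∀ a : ι → ℝ, 0 ≤ a →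
      barrier (MvPolynomial.subDerivs l P) a (z + δ • l.sum) ≤ barrier P a z := by
  induction l with
  | nil => simpa using hz
  | cons c l ih =>
    have h0 : ∀ c ∈ l, 0 ≤ c := fun c hc => hl c (by simp [hc])
    obtain ⟨h1, h2⟩ := ih h0 fun c hc => hb c (by simp [hc])
    have hc := hl c (by simp)
    obtain ⟨h3, h4⟩ := (hP.subDerivs h0).barrier_step h1 hc hδ
      ((h2 c hc).trans (hb c (by simp)))
    have e : z + δ • (c :: l).sum = z + δ • l.sum + δ • c := by
      rw [List.sum_cons, smul_add]
      abel
    rw [e]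
    exact ⟨h3, fun a ha => (h4 a ha).trans (h2 a ha)⟩

variable {κ σ : Type*} [Fintype σ]

/-- If `1 - ∂_c` is an average of operators `1 - ∂_{a s}`, one of these retains positivity. -/
theorem Stable.exists_above_of_average {P : MvPolynomial ι ℝ} (hP : Stable P) {c : ι → ℝ}
    (hc : 0 ≤ c) {a : σ → ι → ℝ} (ha : ∀ s, 0 ≤ a s) [Nonempty σ]
    (hsum : ∑ s, a s = (Fintype.card σ : ℝ) • c) {y : ℝ}
    (hex : ∃ x : ℝ, Above P (x • (1 : ι → ℝ)))
    (hy : Above (P - dirDeriv c P) (y • (1 : ι → ℝ))) :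
    ∃ s, Above (P - dirDeriv (a s) P) (y • (1 : ι → ℝ)) := by
  have hA := hP.above_of_ray hc (y := y) (fun x hx => by
    have := (hy.add_smul zero_le_one (sub_nonneg.2 hx)).pos
    rwa [← add_smul, add_sub_cancel] at this) hex
  by_contra! hcon
  have h1 : ∀ s, eval (y • (1 : ι → ℝ)) P ≤ eval (y • (1 : ι → ℝ)) (dirDeriv (a s) P) := by
    intro s
    by_contra! h
    exact hcon s (hP.above_sub_dirDeriv hA (ha s) ((div_lt_one hA.pos).2 h))
  have h2 := Finset.sum_le_sum fun s (_ : s ∈ Finset.univ) => h1 s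
  rw [← map_sum (eval _) fun s => dirDeriv (a s) P, ← dirDeriv_sum, hsum, dirDeriv_smul,
    Derivation.smul_apply, smul_eval, Finset.sum_const, Finset.card_univ, nsmul_eq_mul] at h2
  have h3 := le_of_mul_le_mul_left h2 (by exact_mod_cast Fintype.card_pos)
  have h4 := hy.pos
  rw [map_sub] at h4
  linarith

theorem Stable.exists_selection [Nonempty σ] {c : κ → ι → ℝ} {a : κ → σ → ι → ℝ}
    (hc : ∀ i, 0 ≤ c i) (ha : ∀ i s, 0 ≤ a i s)
    (hsum : ∀ i, ∑ s, a i s = (Fintype.card σ : ℝ) • c i) {y : ℝ} {l : List κ} (hl : l.Nodup)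
    {P : MvPolynomial ι ℝ} (hP : Stable P) (hex : ∃ x : ℝ, Above P (x • (1 : ι → ℝ)))
    (hy : Above (MvPolynomial.subDerivs (l.map c) P) (y • (1 : ι → ℝ))) :
    ∃ f : κ → σ, Above (MvPolynomial.subDerivs (l.map fun i => a i (f i)) P)
      (y • (1 : ι → ℝ)) := by
  classical
  induction l generalizing P with
  | nil => exact ⟨fun _ => Classical.arbitrary σ, hy⟩
  | cons i l ih =>
    obtain ⟨hi, hl'⟩ := List.nodup_cons.1 hl
    have h0 : ∀ b ∈ l.map c, 0 ≤ b := by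
      simpa using fun j _ => hc j
    obtain ⟨s, hs⟩ := (hP.subDerivs h0).exists_above_of_average (hc i) (ha i) (hsum i)
      (hP.exists_above_subDerivs h0 hex) hy
    rw [← subDerivs_sub_dirDeriv] at hs
    obtain ⟨f, hf⟩ := ih hl' (hP.sub_dirDeriv (ha i s)) (hP.exists_above_sub_dirDeriv (ha i s) hex)
      hs
    refine ⟨Function.update f i s, ?_⟩
    have e : (l.map fun j => a j (Function.update f i s j)) = l.map fun j => a j (f j) := by
      refine List.map_congr_left fun j hj => ?_
      rw [Function.update_of_ne]
      rintro rfl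
      exact hi hj
    rwa [List.map_cons, e, Function.update_self, subDerivs_cons, ← subDerivs_sub_dirDeriv]

theorem Stable.exists_selection_above [Nonempty σ] [Fintype κ] {P : MvPolynomial ι ℝ}
    (hP : Stable P) {c : κ → ι → ℝ} {a : κ → σ → ι → ℝ}
    (hc : ∀ i, 0 ≤ c i) (ha : ∀ i s, 0 ≤ a i s) (hc1 : ∑ i, c i = 1)
    (hsum : ∀ i, ∑ s, a i s = (Fintype.card σ : ℝ) • c i)
    (haff : ∀ i s, dirDeriv (a i s) (dirDeriv (a i s) P) = 0) {t δ : ℝ} (hδ : 0 < δ)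
    (ht : Above P (t • (1 : ι → ℝ)))
    (hb : ∀ i, barrier P (c i) (t • (1 : ι → ℝ)) ≤ 1 - 1 / δ) :
    ∃ f : κ → σ, Above P ((t + δ) • (1 : ι → ℝ) - ∑ i, a i (f i)) := by
  set l := (Finset.univ : Finset κ).toList
  have h1 := (hP.above_subDerivs ht hδ (l := l.map c) (by simpa using fun j _ => hc j)
    (by simpa using fun j _ => hb j)).1
  rw [Finset.sum_map_toList, hc1, ← add_smul] at h1
  obtain ⟨f, hf⟩ := hP.exists_selection hc ha hsum (Finset.nodup_toList _) ⟨t, ht⟩ h1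
  refine ⟨f, fun v hv => ?_⟩
  have := hf v hv
  rw [eval_subDerivs, Finset.sum_map_toList] at this
  · rwa [sub_add_eq_add_sub]
  · simpa using fun j => haff j (f j)

end MvPolynomial

/-! ### Determinants of positive combinations of rank-one matrices -/

namespace Matrix

open Complex
open scoped ComplexOrder

variable {n κ : Type*} [Fintype n] [DecidableEq n]

/-- The determinant is affine along rank-one perturbations. -/
theorem exists_det_add_smul_vecMulVec {R : Type*} [CommRing R] (A : Matrix n n R) (u v : n → R) :
    ∃ α β : R, ∀ t : R, det (A + t • vecMulVec u v) = α + t * β := by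
  set N : Matrix (n ⊕ Unit) (n ⊕ Unit) R := fromBlocks A (replicateCol Unit (-u)) 0 1
  set v₀ : n ⊕ Unit → R := Sum.elim 0 1
  set v₁ : n ⊕ Unit → R := Sum.elim v 0
  refine ⟨(N.updateRow (Sum.inr ()) v₀).det, (N.updateRow (Sum.inr ()) v₁).det, fun t => ?_⟩
  rw [← det_updateRow_smul, ← det_updateRow_add]
  have h : N.updateRow (Sum.inr ()) (v₀ + t • v₁)
      = fromBlocks A (replicateCol Unit (-u)) (t • replicateRow Unit v) 1 := by
    ext i j
    rcases i with i | i <;> rcases j with j | j <;> simp [N, v₀, v₁, updateRow_apply]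
  rw [h, det_fromBlocks_one₂₂]
  congr 1
  ext i j
  simp [mul_apply, vecMulVec_apply]

theorem det_smul_one_add_smul_vecMulVec {K : Type*} [Field K] {t : K} (ht : t ≠ 0) (τ : K)
    (u v : n → K) : det (t • (1 : Matrix n n K) + τ • vecMulVec u v)
      = t ^ Fintype.card n * (1 + τ * ((v ⬝ᵥ u) / t)) := by
  have h : t • (1 : Matrix n n K) + τ • vecMulVec u v
      = t • (1 + replicateCol Unit ((τ / t) • u) * replicateRow Unit v) := by
    ext i j
    simp [vecMulVec_apply, mul_apply]
    field_simp
  rw [h, det_smul, det_one_add_replicateCol_mul_replicateRow, dotProduct_smul, smul_eq_mul]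
  ring

variable [Fintype κ] {w : κ → n → ℂ}

theorem det_sum_smul_vecMulVec_ne_zero (hw : ∑ i, vecMulVec (w i) (star (w i)) = 1) {z : κ → ℂ}
    (hz : ∀ i, 0 < (z i).im) : det (∑ i, z i • vecMulVec (w i) (star (w i))) ≠ 0 := by
  intro h0
  obtain ⟨x, hx, hMx⟩ := exists_mulVec_eq_zero_iff.2 h0
  have h1 : ∑ i, z i * (normSq (star (w i) ⬝ᵥ x) : ℂ) = 0 := by
    have := congrArg (star x ⬝ᵥ ·) hMx
    simp only [sum_mulVec, smul_mulVec, vecMulVec_mulVec, dotProduct_sum, dotProduct_smul,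
      dotProduct_zero] at this
    rw [← this]
    refine Finset.sum_congr rfl fun i _ => ?_
    have h2 : star x ⬝ᵥ w i = (starRingEnd ℂ) (star (w i) ⬝ᵥ x) := by
      rw [starRingEnd_apply, star_dotProduct]
    rw [h2, smul_eq_mul, op_smul_eq_mul, ← mul_conj, mul_comm ((starRingEnd ℂ) _)]
  have h2 := congrArg im h1
  simp only [im_sum, im_mul_ofReal, zero_im] at h2
  rw [Finset.sum_eq_zero_iff_of_nonneg fun i _ => mul_nonneg (hz i).le (normSq_nonneg _)] at h2
  apply hx
  rw [← one_mulVec x, ← hw, sum_mulVec]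
  refine Finset.sum_eq_zero fun i hi => ?_
  have h3 : star (w i) ⬝ᵥ x = 0 := by
    simpa [(hz i).ne'] using h2 i hi
  simp [vecMulVec_mulVec, h3]

theorem det_sum_smul_vecMulVec_pos (hw : ∑ i, vecMulVec (w i) (star (w i)) = 1) {t : ℝ}
    (ht : 0 < t) {y : κ → ℝ} (hy : 0 ≤ y) :
    0 < det (∑ i, ((t + y i : ℝ) : ℂ) • vecMulVec (w i) (star (w i))) := by
  apply PosDef.det_pos
  simp only [ofReal_add, add_smul, Finset.sum_add_distrib]
  rw [← Finset.smul_sum, hw]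
  refine PosDef.add_posSemidef ?_ (posSemidef_sum _ fun i _ => ?_)
  · exact PosDef.one.smul (by exact_mod_cast ht)
  · exact (posSemidef_vecMulVec_self_star _).smul (by exact_mod_cast hy i)

end Matrix

namespace MvPolynomial

open Complex

variable {ι κ σ n : Type*}

theorem exists_map_ofReal_eq {P : MvPolynomial ι ℂ} (hP : map (starRingEnd ℂ) P = P) :
    ∃ Q : MvPolynomial ι ℝ, map ofRealHom Q = P := by
  change P ∈ Set.range _
  rw [mem_range_map_iff_coeffs_subset]
  intro c hc
  obtain ⟨k, -, rfl⟩ := mem_coeffs_iff.1 hc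
  have := congrArg (coeff k) hP
  rw [coeff_map, conj_eq_iff_real] at this
  obtain ⟨r, hr⟩ := this
  exact ⟨r, hr.symm⟩

theorem exists_prod_det [Fintype κ] [Fintype σ] [Fintype n] [DecidableEq n]
    {B : κ → Matrix n n ℂ} (hB : ∀ i, (B i).IsHermitian) :
    ∃ Q : MvPolynomial (κ × σ) ℝ, ∀ z : κ × σ → ℂ,
      aeval z Q = ∏ s, Matrix.det (∑ i, z (i, s) • B i) := by
  set M : σ → Matrix n n (MvPolynomial (κ × σ) ℂ) := fun s =>
    ∑ i, (X (i, s) : MvPolynomial (κ × σ) ℂ) • (B i).map C with hM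
  obtain ⟨Q, hQ⟩ := exists_map_ofReal_eq (P := ∏ s, (M s).det) (by
    rw [map_prod]
    refine Finset.prod_congr rfl fun s _ => ?_
    rw [RingHom.map_det, ← Matrix.det_transpose]
    congr 1
    ext1 i j
    simp only [hM, RingHom.mapMatrix_apply, Matrix.transpose_apply, Matrix.map_apply,
      Matrix.sum_apply, Matrix.smul_apply, smul_eq_mul, map_sum, map_mul, map_X, map_C]
    refine Finset.sum_congr rfl fun k _ => ?_
    rw [starRingEnd_apply, (hB k).apply])
  refine ⟨Q, fun z => ?_⟩
  have h : aeval z Q = eval z (map ofRealHom Q) := by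
    rw [eval_map, aeval_def]
    rfl
  rw [h, hQ, map_prod]
  refine Finset.prod_congr rfl fun s _ => ?_
  rw [RingHom.map_det]
  congr 1
  ext1 i j
  simp [hM, Matrix.sum_apply]

end MvPolynomial

open Complex in
open scoped ComplexOrder in
/-- A bound for the operator norm of a positive semidefinite matrix from the location of its
characteristic roots. -/
theorem Matrix.PosSemidef.norm_toEuclideanCLM_le {n : Type*} [Fintype n] [DecidableEq n]
    {G : Matrix n n ℂ} (hG : G.PosSemidef) {b : ℝ} (hb : 0 ≤ b)
    (h : ∀ x : ℝ, b < x → ((x : ℂ) • (1 : Matrix n n ℂ) - G).det ≠ 0) :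
    ‖Matrix.toEuclideanCLM (𝕜 := ℂ) G‖ ≤ b := by
  set T := Matrix.toEuclideanCLM (𝕜 := ℂ) G
  have hT : IsSelfAdjoint T := by
    have : star G = G := hG.isHermitian
    rw [isSelfAdjoint_iff, ← map_star, this]
  have hle : spectralRadius ℂ T ≤ ENNReal.ofReal b := by
    refine iSup₂_le fun k hk => ?_
    have hre := hT.mem_spectrum_eq_re hk
    rw [AlgEquiv.spectrum_eq (Matrix.toEuclideanCLM (𝕜 := ℂ) (n := n)), spectrum.mem_iff,
      Matrix.isUnit_iff_isUnit_det, isUnit_iff_ne_zero, not_not, Algebra.algebraMap_eq_smul_one,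
      hre] at hk
    have h1 : k.re ≤ b := by
      by_contra! hlt
      exact h _ hlt hk
    have h2 : 0 ≤ k.re := by
      by_contra! hlt
      have hp : ((-(k.re : ℂ)) • (1 : Matrix n n ℂ) + G).PosDef :=
        (Matrix.PosDef.one.smul (by
          rw [← ofReal_neg]
          exact_mod_cast neg_pos.2 hlt)).add_posSemidef hG
      apply hp.det_pos.ne'
      have e : (-(k.re : ℂ)) • (1 : Matrix n n ℂ) + G = -((k.re : ℂ) • (1 : Matrix n n ℂ) - G) := by
        rw [neg_smul]
        abel
      rw [e, Matrix.det_neg, hk, mul_zero]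
    rw [← enorm_eq_nnnorm, ← ofReal_norm, hre, norm_real, Real.norm_of_nonneg h2]
    exact ENNReal.ofReal_le_ofReal h1
  rwa [hT.spectralRadius_eq_nnnorm, ← enorm_eq_nnnorm, ← ofReal_norm,
    ENNReal.ofReal_le_ofReal_iff hb] at hle

namespace MvPolynomial

open Complex Matrix

open scoped ComplexOrder

variable {κ σ n : Type*} [Fintype κ] [Fintype σ] [Fintype n] [DecidableEq n]
  {w : κ → n → ℂ} {Q : MvPolynomial (κ × σ) ℝ}

theorem stable_of_aeval_eq_prod_det (hw : ∑ i, vecMulVec (w i) (star (w i)) = 1)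
    (hQ : ∀ z : κ × σ → ℂ,
      aeval z Q = ∏ s, det (∑ i, z (i, s) • vecMulVec (w i) (star (w i)))) : Stable Q := by
  intro z hz
  rw [hQ, Finset.prod_ne_zero_iff]
  exact fun s _ => det_sum_smul_vecMulVec_ne_zero hw fun i => hz (i, s)

theorem above_of_aeval_eq_prod_det (hw : ∑ i, vecMulVec (w i) (star (w i)) = 1)
    (hQ : ∀ z : κ × σ → ℂ,
      aeval z Q = ∏ s, det (∑ i, z (i, s) • vecMulVec (w i) (star (w i)))) {t : ℝ} (ht : 0 < t) :
    Above Q (t • (1 : κ × σ → ℝ)) := by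
  intro y hy
  have h : (0 : ℂ) < (eval (t • (1 : κ × σ → ℝ) + y) Q : ℝ) := by
    rw [← aeval_ofReal, hQ]
    refine Finset.prod_pos fun s _ => ?_
    simpa using det_sum_smul_vecMulVec_pos hw ht (y := fun i => y (i, s)) fun i => hy (i, s)
  exact_mod_cast h

theorem barrier_of_aeval_eq_prod_det [DecidableEq κ]
    (hw : ∑ i, vecMulVec (w i) (star (w i)) = 1)
    (hQ : ∀ z : κ × σ → ℂ,
      aeval z Q = ∏ s, det (∑ i, z (i, s) • vecMulVec (w i) (star (w i)))) {t : ℝ} (ht : 0 < t)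
    (i : κ) {ν : ℝ} (hν : star (w i) ⬝ᵥ w i = ν) :
    barrier Q (fun p => if p.1 = i then 1 else 0) (t • (1 : κ × σ → ℝ))
      = Fintype.card σ * (ν / t) := by
  set c : κ × σ → ℝ := fun p => if p.1 = i then 1 else 0 with hc
  have hev : ∀ τ : ℝ, eval (t • (1 : κ × σ → ℝ) + τ • c) Q
      = (t ^ Fintype.card n * (1 + τ * (ν / t))) ^ Fintype.card σ := by
    intro τ
    apply ofReal_injective
    rw [← aeval_ofReal, hQ]
    have h1 : ∀ s, (∑ j, (((t • (1 : κ × σ → ℝ) + τ • c) (j, s) : ℝ) : ℂ)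
        • vecMulVec (w j) (star (w j)))
        = (t : ℂ) • (1 : Matrix n n ℂ) + (τ : ℂ) • vecMulVec (w i) (star (w i)) := by
      intro s
      simp only [hc, Pi.add_apply, Pi.smul_apply, Pi.one_apply, smul_eq_mul, mul_one, ofReal_add,
        add_smul, Finset.sum_add_distrib]
      rw [← Finset.smul_sum, hw, Finset.sum_eq_single i (fun j _ hj => by simp [hj]) (by simp)]
      simp
    simp only [h1, det_smul_one_add_smul_vecMulVec (ofReal_ne_zero.2 ht.ne'), hν,
      Finset.prod_const, Finset.card_univ]
    push_cast
    rfl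
  have h1 := hasDerivAt_eval_add_smul (t • (1 : κ × σ → ℝ)) c Q 0
  have h2 := (((((hasDerivAt_id (0 : ℝ)).mul_const (ν / t)).const_add 1).const_mul
    (t ^ Fintype.card n)).fun_pow (Fintype.card σ))
  have h3 := (h1.congr_of_eventuallyEq
    (Filter.Eventually.of_forall fun τ => (hev τ).symm)).unique h2
  have h4 := hev 0
  rw [zero_smul, add_zero] at h3 h4
  rw [barrier, h3, h4]
  rcases Nat.eq_zero_or_pos (Fintype.card σ) with h | h
  · simp [h]
  · obtain ⟨k, hk⟩ := Nat.exists_eq_succ_of_ne_zero h.ne'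
    rw [hk]
    simp
    field_simp
    ring

theorem dirDeriv_dirDeriv_of_aeval_eq_prod_det [DecidableEq κ] [DecidableEq σ]
    (hQ : ∀ z : κ × σ → ℂ,
      aeval z Q = ∏ s, det (∑ i, z (i, s) • vecMulVec (w i) (star (w i)))) (p : κ × σ) (b : ℝ) :
    dirDeriv (Pi.single p b) (dirDeriv (Pi.single p b) Q) = 0 := by
  obtain ⟨i, s⟩ := p
  set a : κ × σ → ℝ := Pi.single (i, s) b with ha
  apply funext
  intro z
  obtain ⟨α, β, hαβ⟩ := exists_det_add_smul_vecMulVec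
    (∑ j, (z (j, s) : ℂ) • vecMulVec (w j) (star (w j))) (w i) (star (w i))
  set γ := ∏ s' ∈ Finset.univ.erase s, det (∑ j, (z (j, s') : ℂ) • vecMulVec (w j) (star (w j)))
  have hev : ∀ t : ℝ, eval (z + t • a) Q = (α * γ).re + t * (b * (β * γ).re) := by
    intro t
    have h : ((eval (z + t • a) Q : ℝ) : ℂ) = (α + (t * b : ℝ) * β) * γ := by
      rw [← aeval_ofReal, hQ, ← Finset.mul_prod_erase _ _ (Finset.mem_univ s)]
      congr 1
      · rw [← hαβ]
        congr 1
        simp only [Pi.add_apply, Pi.smul_apply, smul_eq_mul, ofReal_add,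
          add_smul, Finset.sum_add_distrib]
        rw [Finset.sum_eq_single (f := fun j => ((t * a (j, s) : ℝ) : ℂ) • _) i
          (fun j _ hj => by simp [ha, hj]) (by simp)]
        simp [ha]
      · refine Finset.prod_congr rfl fun s' hs' => ?_
        have := Finset.ne_of_mem_erase hs'
        simp [ha, this]
    have h' := congrArg re h
    rw [ofReal_re, add_mul, mul_assoc, add_re, re_ofReal_mul] at h'
    rw [h']
    ring
  have h1 : ∀ t : ℝ, eval (z + t • a) (dirDeriv a Q) = b * (β * γ).re := by
    intro t
    have h2 := ((hasDerivAt_id t).mul_const (b * (β * γ).re)).const_add (α * γ).re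
    have h3 := ((hasDerivAt_eval_add_smul z a Q t).congr_of_eventuallyEq
      (Filter.Eventually.of_forall fun τ => (hev τ).symm)).unique h2
    simpa using h3
  have h2 := ((hasDerivAt_eval_add_smul z a (dirDeriv a Q) 0).congr_of_eventuallyEq
    (Filter.Eventually.of_forall fun τ => (h1 τ).symm)).unique (hasDerivAt_const _ _)
  simpa using h2

end MvPolynomial

open scoped ComplexOrder in
/-- For vectors forming a resolution of the identity there is an assignment of the vectors to `σ`
such that the parts all satisfy the spectral bound of Marcus, Spielman and Srivastava. -/
theorem exists_assignment_det_ne_zero {n κ σ : Type*} [Fintype n] [DecidableEq n] [Fintype κ]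
    [Fintype σ] [Nonempty σ] [DecidableEq σ] {w : κ → n → ℂ} {δ : ℝ} (hδ : 0 < δ)
    (hw : ∑ i, Matrix.vecMulVec (w i) (star (w i)) = 1)
    (hnorm : ∀ i, ∃ ν : ℝ, ν ≤ δ ∧ star (w i) ⬝ᵥ w i = ν) :
    ∃ f : κ → σ, ∀ x : ℝ, (1 + √(Fintype.card σ * δ)) ^ 2 ≤ x → ∀ s,
      Matrix.det ((x : ℂ) • (1 : Matrix n n ℂ) - (Fintype.card σ : ℂ) •
        ∑ i with f i = s, Matrix.vecMulVec (w i) (star (w i))) ≠ 0 := by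
  classical
  set r := (Fintype.card σ : ℝ)
  have hr : 0 < r := Nat.cast_pos.2 Fintype.card_pos
  obtain ⟨Q, hQ⟩ := MvPolynomial.exists_prod_det (σ := σ)
    (B := fun i => Matrix.vecMulVec (w i) (star (w i)))
    fun i => (Matrix.posSemidef_vecMulVec_self_star (w i)).isHermitian
  set q := √(r * δ)
  have hq : 0 < q := Real.sqrt_pos.2 (mul_pos hr hδ)
  have hq2 : q * q = r * δ := Real.mul_self_sqrt (mul_pos hr hδ).le
  have ht : 0 < q + q * q := by positivity
  obtain ⟨f, hf⟩ := (MvPolynomial.stable_of_aeval_eq_prod_det hw hQ).exists_selection_above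
    (c := fun i p => if p.1 = i then 1 else 0) (a := fun i s => Pi.single (i, s) r)
    (t := q + q * q) (δ := 1 + q)
    (fun i p => by dsimp only; split_ifs <;> simp) (fun i s => Pi.single_nonneg.2 hr.le)
    (by ext p; simp)
    (fun i => by
      ext ⟨j, s⟩
      rw [Finset.sum_apply, Finset.sum_eq_single s (fun s' _ hs' => by simp [hs'.symm]) (by simp)]
      by_cases h : j = i <;> simp [h, r])
    (fun i s => MvPolynomial.dirDeriv_dirDeriv_of_aeval_eq_prod_det hQ _ _) (by positivity)
    (MvPolynomial.above_of_aeval_eq_prod_det hw hQ ht)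
    (fun i => by
      obtain ⟨ν, hν, hν'⟩ := hnorm i
      rw [MvPolynomial.barrier_of_aeval_eq_prod_det hw hQ ht i hν', ← mul_div_assoc,
        div_le_iff₀ ht]
      have e : (1 - 1 / (1 + q)) * (q + q * q) = q * q := by
        field_simp
        ring
      rw [e, hq2]
      exact mul_le_mul_of_nonneg_left hν hr.le)
  refine ⟨f, fun x hx s => ?_⟩
  set W : κ × σ → ℝ :=
    (q + q * q + (1 + q)) • 1 - ∑ i, Pi.single (i, f i) r + (x - (1 + q) ^ 2) • 1 with hW
  have h1 : 0 < MvPolynomial.eval W Q :=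
    hf ((x - (1 + q) ^ 2) • 1) (smul_nonneg (sub_nonneg.2 hx) zero_le_one)
  have h2 := hQ fun p => (W p : ℂ)
  rw [MvPolynomial.aeval_ofReal] at h2
  have h3 : ∏ s, _ ≠ (0 : ℂ) := h2 ▸ Complex.ofReal_ne_zero.2 h1.ne'
  convert Finset.prod_ne_zero_iff.1 h3 s (Finset.mem_univ s) using 2
  have e : ∀ i, W (i, s) = x - if f i = s then r else 0 := by
    intro i
    have e1 : (∑ i, Pi.single (i, f i) r : κ × σ → ℝ) (i, s) = if f i = s then r else 0 := by
      rw [Finset.sum_apply, Finset.sum_eq_single i (fun j _ hj => by simp [hj.symm]) (by simp)]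
      by_cases h : f i = s
      · simp [h]
      · simp [h, Ne.symm h]
    simp only [hW, Pi.add_apply, Pi.sub_apply, e1, Pi.smul_apply, Pi.one_apply, smul_eq_mul]
    ring
  simp only [e, Complex.ofReal_sub, sub_smul, Finset.sum_sub_distrib]
  rw [← Finset.smul_sum, hw, Finset.smul_sum, Finset.sum_filter]
  congr 1
  refine Finset.sum_congr rfl fun i _ => ?_
  split_ifs <;> simp [r]

/-- **Marcus–Spielman–Srivastava.** Let `r > 1` be an integer and
`δ > 0`, and let `u₁, …, u_m ∈ ℂ^d` satisfy `∑ᵢ uᵢuᵢ* = I_d` and `‖uᵢ‖² ≤ δ` for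
all `i`. Then there is a partition `A₁, …, A_r` of `{1, …, m}` such that
`‖∑_{i ∈ A_j} uᵢuᵢ*‖ ≤ (1/r)(1 + √(rδ))²` for every `j`. -/
theorem exists_partition_opNorm_le
    {d m : ℕ} (r : ℕ) (hr : 1 < r) (δ : ℝ) (hδ : 0 < δ)
    (u : Fin m → EuclideanSpace ℂ (Fin d))
    (hsum : (∑ i, outer (u i)) = (1 : Matrix (Fin d) (Fin d) ℂ))
    (hnorm : ∀ i, ‖u i‖ ^ 2 ≤ δ) :
    ∃ A : Fin r → Finset (Fin m),
      (∀ i : Fin m, ∃! j : Fin r, i ∈ A j) ∧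
      ∀ j : Fin r,
        matOpNorm (∑ i ∈ A j, outer (u i)) ≤ (1 / r) * (1 + Real.sqrt (r * δ)) ^ 2 := by
  have hr0 : (0 : ℝ) < r := by exact_mod_cast zero_lt_one.trans hr
  have : Nonempty (Fin r) := ⟨⟨0, zero_lt_one.trans hr⟩⟩
  have houter : ∀ i, outer (u i) = Matrix.vecMulVec (u i).ofLp (star (u i).ofLp) := fun i => rfl
  simp only [houter] at hsum ⊢
  obtain ⟨f, hf⟩ := exists_assignment_det_ne_zero (σ := Fin r) hδ hsum fun i =>
    ⟨‖u i‖ ^ 2, hnorm i, by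
      rw [dotProduct_comm, ← EuclideanSpace.inner_eq_star_dotProduct, inner_self_eq_norm_sq_to_K]
      simp⟩
  refine ⟨fun j => {i | f i = j}, fun i => ⟨f i, by simp, by simp⟩, fun j => ?_⟩
  open scoped ComplexOrder in
  refine Matrix.PosSemidef.norm_toEuclideanCLM_le
    (Matrix.posSemidef_sum _ fun i _ => Matrix.posSemidef_vecMulVec_self_star _)
    (by positivity) fun x hx => ?_
  rw [one_div, inv_mul_lt_iff₀ hr0] at hx
  have h := hf (r * x) (by simpa using hx.le) j
  rw [Fintype.card_fin, Complex.ofReal_mul, Complex.ofReal_natCast, mul_smul, ← smul_sub,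
    Matrix.det_smul] at h
  exact right_ne_zero_of_mul h

end
end

section
/- Let f be a nonconstant polynomial with real coefficients all of whose roots are real (counted with multiplicity, f has deg f real roots), and let c ∈ ℝ. Then all roots of the polynomial f − c·f′ are real. -/
/-- The imaginary part of the partial fraction sum `∑ 1 / (z - a)` over real `a`. -/
lemma Complex.im_sum_one_div_sub_ofReal (s : Multiset ℝ) (z : ℂ) :
    (s.map fun a : ℝ ↦ 1 / (z - (a : ℂ))).sum.im =
      -z.im * (s.map fun a : ℝ ↦ (Complex.normSq (z - (a : ℂ)))⁻¹).sum := by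
  induction s using Multiset.induction_on with
  | empty => simp
  | cons a s ih =>
    rw [Multiset.map_cons, Multiset.map_cons, Multiset.sum_cons, Multiset.sum_cons,
      Complex.add_im, ih, one_div, Complex.inv_im, Complex.sub_im, Complex.ofReal_im]
    ring

/-- At a nonreal point the partial fraction sum `∑ 1 / (z - a)` over a nonempty multiset of real
numbers is not real. -/
lemma Complex.im_sum_one_div_sub_ofReal_ne_zero {s : Multiset ℝ} (hs : s ≠ 0) {z : ℂ}
    (hz : z.im ≠ 0) : (s.map fun a : ℝ ↦ 1 / (z - (a : ℂ))).sum.im ≠ 0 := by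
  have hpos (a : ℝ) : 0 < (Complex.normSq (z - (a : ℂ)))⁻¹ := by
    refine inv_pos.2 (Complex.normSq_pos.2 fun h ↦ hz ?_)
    simpa using congrArg Complex.im h
  obtain ⟨a, ha⟩ := Multiset.exists_mem_of_ne_zero hs
  obtain ⟨t, rfl⟩ := Multiset.exists_cons_of_mem ha
  have ht : 0 ≤ (t.map fun a : ℝ ↦ (Complex.normSq (z - (a : ℂ)))⁻¹).sum :=
    Multiset.sum_nonneg fun x hx ↦ by
      obtain ⟨b, -, rfl⟩ := Multiset.mem_map.1 hx
      exact (hpos b).le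
  rw [Complex.im_sum_one_div_sub_ofReal, Multiset.map_cons, Multiset.sum_cons]
  exact mul_ne_zero (neg_ne_zero.2 hz) (add_pos_of_pos_of_nonneg (hpos a) ht).ne'

/-- Let `f` be a nonconstant real polynomial all of whose roots are
real (its multiset of real roots, counted with multiplicity, has size `deg f`), and
let `c ∈ ℝ`. Then all roots of `f − c·f′` are real. -/
theorem roots_real_of_sub_smul_derivative
    (f : Polynomial ℝ) (hdeg : 0 < f.natDegree)
    (hroots : f.roots.card = f.natDegree) (c : ℝ) :
    (f - Polynomial.C c * Polynomial.derivative f).roots.card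
      = (f - Polynomial.C c * Polynomial.derivative f).natDegree := by
  have hf : f.Splits := Polynomial.splits_iff_card_roots.2 hroots
  have hs : f.roots ≠ 0 := by
    rw [← Multiset.card_pos, hroots]
    exact hdeg
  have hf0 : f ≠ 0 := by
    rintro rfl
    simp at hdeg
  rw [← Polynomial.splits_iff_card_roots]
  refine Polynomial.Splits.of_splits_map Complex.ofRealHom (IsAlgClosed.splits _) fun z hz ↦ ?_
  by_cases hfz : (f.map Complex.ofRealHom).eval z = 0
  · exact hf.mem_range_of_isRoot hf0 hfz
  have hroot := Polynomial.isRoot_of_mem_roots hz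
  rw [Polynomial.IsRoot, Polynomial.map_sub, Polynomial.map_mul, Polynomial.map_C,
    ← Polynomial.derivative_map, Polynomial.eval_sub, Polynomial.eval_mul, Polynomial.eval_C,
    (hf.map _).eval_derivative_eq_eval_mul_sum hfz, hf.roots_map, Multiset.map_map] at hroot
  set S := (f.roots.map ((fun a : ℂ ↦ 1 / (z - a)) ∘ Complex.ofRealHom)).sum
  have hcS : (c : ℂ) * S = 1 := by
    refine mul_left_cancel₀ hfz ?_
    rw [Complex.ofRealHom_eq_coe] at hroot
    linear_combination -hroot
  have hc : c ≠ 0 := by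
    rintro rfl
    simp at hcS
  have hSim : S.im = 0 := by
    simpa [hc] using congrArg Complex.im hcS
  have hzim : z.im = 0 := by
    by_contra h
    exact Complex.im_sum_one_div_sub_ofReal_ne_zero hs h hSim
  exact ⟨z.re, Complex.ext rfl hzim.symm⟩
end

section
/- For every real δ, and all integers n ≥ 0 and k ≥ 0, all roots of the polynomial (1 − δ·d/dx)^k applied to xⁿ are real. -/
/-- For nonreal `z`, the sum of `1 / (z - a)` over a nonempty multiset of reals has imaginary part
of sign opposite to that of `z`. -/
theorem Complex.im_mul_im_sum_one_div_sub_neg {z : ℂ} (hz : z.im ≠ 0) {s : Multiset ℝ}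
    (hs : s ≠ 0) :
    z.im * (s.map fun a : ℝ ↦ 1 / (z - (a : ℂ))).sum.im < 0 := by
  have term (a : ℝ) : z.im * (1 / (z - (a : ℂ))).im < 0 := by
    have h : 0 < Complex.normSq (z - a) :=
      Complex.normSq_pos.mpr fun h ↦ hz (by simpa using congrArg Complex.im h)
    have h2 : 0 < z.im ^ 2 / Complex.normSq (z - a) := by positivity
    have : z.im * (1 / (z - (a : ℂ))).im = -(z.im ^ 2 / Complex.normSq (z - a)) := by
      simp only [one_div, Complex.inv_im, Complex.sub_im, Complex.ofReal_im, sub_zero]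
      ring
    linarith
  induction s using Multiset.induction with
  | empty => exact absurd rfl hs
  | cons a s ih =>
    rw [Multiset.map_cons, Multiset.sum_cons, Complex.add_im, mul_add]
    rcases eq_or_ne s 0 with rfl | h
    · simpa using term a
    · exact add_neg (term a) (ih h)

namespace Polynomial

/-- The operator `f ↦ f - δ f'` preserves real-rootedness. -/
theorem Splits.sub_C_mul_derivative {f : ℝ[X]} (hf : f.Splits) (δ : ℝ) :
    (f - C δ * derivative f).Splits := by
  refine .of_splits_map Complex.ofRealHom (IsAlgClosed.splits _) fun z hz ↦ ?_
  have hroot : (f.map Complex.ofRealHom).eval z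
      = δ * (derivative (f.map Complex.ofRealHom)).eval z := by
    have := isRoot_of_mem_roots hz
    simpa [sub_eq_zero, derivative_map] using this
  have hf0 : f ≠ 0 := by
    rintro rfl
    simp at hz
  by_cases hfz : (f.map Complex.ofRealHom).eval z = 0
  · exact hf.mem_range_of_isRoot hf0 hfz
  rw [(hf.map Complex.ofRealHom).eval_derivative_eq_eval_mul_sum hfz, hf.roots_map,
    Multiset.map_map, mul_left_comm, eq_comm, mul_eq_left₀ hfz] at hroot
  have him : z.im = 0 := by
    by_contra hz
    have hs : f.roots ≠ 0 := fun h ↦ by simp [h] at hroot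
    have hneg := Complex.im_mul_im_sum_one_div_sub_neg hz hs
    have h := congrArg Complex.im hroot
    rw [Complex.im_ofReal_mul, Complex.one_im, mul_eq_zero] at h
    rcases h with rfl | h
    · simp at hroot
    · exact hneg.ne (mul_eq_zero_of_right _ h)
  exact ⟨z.re, Complex.ext rfl (by simp [him])⟩

end Polynomial

/-- For every real `δ` and all naturals `n, k`, all roots of the
polynomial `(1 − δ·d/dx)^k xⁿ` are real: its multiset of real roots, counted with
multiplicity, has size equal to its degree. -/
theorem roots_real_iterated_derivative_operator
    (δ : ℝ) (n k : ℕ) :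
    ((fun f : Polynomial ℝ => f - Polynomial.C δ * Polynomial.derivative f)^[k]
        (Polynomial.X ^ n)).roots.card
      = ((fun f : Polynomial ℝ => f - Polynomial.C δ * Polynomial.derivative f)^[k]
        (Polynomial.X ^ n)).natDegree := by
  refine (Polynomial.Splits.natDegree_eq_card_roots ?_).symm
  induction k with
  | zero => exact Polynomial.Splits.X_pow n
  | succ k ih =>
    rw [Function.iterate_succ_apply']
    exact ih.sub_C_mul_derivative δ
end
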